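/- Let q be a minimal Boolean conjunctive query with connected components q1, q2, ..., qn. Then for every database instance db: every repair of db satisfies q if and only if for every 1 ≤ i ≤ n, every repair of db satisfies qi. -/

import Mathlib

namespace CQAG

/-- A term of a general Boolean conjunctive query: a variable (`inl`) or a constant (`inr`). -/
abbrev GTerm := ℕ ⊕ ℕ

/-- An atom: relation name together with its list of arguments. -/
abbrev GAtom := ℕ × List GTerm

/-- A fact: relation name together with its list of (constant) arguments. -/
abbrev GFact := ℕ × List ℕ

def gApplyT (θ : ℕ → ℕ) : GTerm → ℕ
  | .inl v => θ v
  | .inr c => c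

/-- Applying a valuation to an atom yields a fact. -/
def gApply (θ : ℕ → ℕ) (a : GAtom) : GFact := (a.1, a.2.map (gApplyT θ))

/-- An instance `r` satisfies a Boolean conjunctive query `q`. -/
def GSat (r : Set GFact) (q : Finset GAtom) : Prop := ∃ θ : ℕ → ℕ, ∀ a ∈ q, gApply θ a ∈ r

/-- Key-equality relative to primary-key positions `pk R` of each relation name `R`:
same relation name, agreeing on all primary-key positions. -/
def GKeyEq (pk : ℕ → Set ℕ) (f g : GFact) : Prop :=
  f.1 = g.1 ∧ ∀ i ∈ pk f.1, f.2[i]? = g.2[i]?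

def GConsistent (pk : ℕ → Set ℕ) (s : Set GFact) : Prop :=
  ∀ f ∈ s, ∀ g ∈ s, GKeyEq pk f g → f = g

/-- A repair: inclusion-maximal consistent subset. -/
def GIsRepair (pk : ℕ → Set ℕ) (db r : Set GFact) : Prop :=
  r ⊆ db ∧ GConsistent pk r ∧ ∀ s, r ⊆ s → s ⊆ db → GConsistent pk s → s = r

/-- Logical equivalence of Boolean conjunctive queries (over all database instances). -/
def GEquiv (p q : Finset GAtom) : Prop :=
  ∀ r : Set GFact, r.Finite → (GSat r p ↔ GSat r q)

/-- A minimal query: no logically equivalent query has strictly fewer atoms. -/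
def GMinimal (q : Finset GAtom) : Prop :=
  ∀ p : Finset GAtom, GEquiv p q → q.card ≤ p.card

/-- Two atoms share a variable. -/
def sharesVar (a b : GAtom) : Prop :=
  ∃ v : ℕ, (Sum.inl v : GTerm) ∈ a.2 ∧ (Sum.inl v : GTerm) ∈ b.2

/-- A set of atoms is connected (in the graph whose vertices are the atoms, adjacent
atoms being those sharing a variable). -/
def ConnectedQ (p : Finset GAtom) : Prop :=
  ∀ s ⊆ p, s.Nonempty → s ≠ p → ∃ a ∈ s, ∃ b ∈ p \ s, sharesVar a b

/-- `qs` is the list of connected components of `q`. -/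
def IsComponents (q : Finset GAtom) (qs : List (Finset GAtom)) : Prop :=
  (∀ p ∈ qs, p.Nonempty ∧ ConnectedQ p ∧ p ⊆ q) ∧
  q = qs.foldr (· ∪ ·) ∅ ∧
  qs.Pairwise (fun p p' => Disjoint p p' ∧ ∀ a ∈ p, ∀ b ∈ p', ¬ sharesVar a b)

/-- The variables of a query. -/
def gvars (p : Finset GAtom) : Set ℕ := {v | ∃ a ∈ p, (Sum.inl v : GTerm) ∈ a.2}

/-- The constants of a query. -/
def gconsts (p : Finset GAtom) : Set ℕ := {c | ∃ a ∈ p, (Sum.inr c : GTerm) ∈ a.2}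

/-- The constants occurring in a set of facts. -/
def gdbConsts (db : Set GFact) : Set ℕ := {c | ∃ f ∈ db, c ∈ f.2}

/-- The copy `θ(p)` of a query `p` under a valuation `θ`. -/
def gcopy (θ : ℕ → ℕ) (p : Finset GAtom) : Set GFact := (gApply θ) '' ↑p

end CQAG

namespace CQAG

theorem gApply_congr {θ θ' : ℕ → ℕ} {a : GAtom}
    (h : ∀ v, (Sum.inl v : GTerm) ∈ a.2 → θ v = θ' v) : gApply θ a = gApply θ' a := by
  refine Prod.ext rfl (List.map_congr_left fun t ht => ?_)
  cases t with
  | inl v => exact h v ht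
  | inr c => rfl

theorem GSat.mono {r : Set GFact} {p q : Finset GAtom} (hq : GSat r q) (hpq : p ⊆ q) :
    GSat r p :=
  hq.imp fun _ hθ a ha => hθ a (hpq ha)

/-- Queries without common variables that hold separately hold jointly. -/
theorem GSat.union {r : Set GFact} {p q : Finset GAtom} (hp : GSat r p) (hq : GSat r q)
    (hpq : ∀ a ∈ p, ∀ b ∈ q, ¬ sharesVar a b) : GSat r (p ∪ q) := by
  classical
  obtain ⟨θ, hθ⟩ := hp
  obtain ⟨η, hη⟩ := hq
  refine ⟨fun v => if v ∈ gvars p then θ v else η v, fun a ha => ?_⟩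
  rcases Finset.mem_union.mp ha with ha | ha
  · rw [gApply_congr (θ' := θ) fun v hv => if_pos ⟨a, ha, hv⟩]
    exact hθ a ha
  · rw [gApply_congr (θ' := η) fun v hv =>
      if_neg fun ⟨b, hb, hvb⟩ => hpq b hb a ha ⟨v, hvb, hv⟩]
    exact hη a ha

theorem mem_foldr_union {qs : List (Finset GAtom)} {a : GAtom} :
    a ∈ qs.foldr (· ∪ ·) ∅ ↔ ∃ p ∈ qs, a ∈ p := by
  induction qs with
  | nil => simp
  | cons p qs ih => simp [ih]

theorem GSat.foldr_union {r : Set GFact} {qs : List (Finset GAtom)}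
    (hdisj : qs.Pairwise fun p p' => ∀ a ∈ p, ∀ b ∈ p', ¬ sharesVar a b)
    (hsat : ∀ p ∈ qs, GSat r p) : GSat r (qs.foldr (· ∪ ·) ∅) := by
  induction qs with
  | nil => exact ⟨id, by simp⟩
  | cons p qs ih =>
    obtain ⟨hp, hqs⟩ := List.pairwise_cons.mp hdisj
    refine (hsat p List.mem_cons_self).union
      (ih hqs fun p' hp' => hsat p' (List.mem_cons_of_mem _ hp')) fun a ha b hb => ?_
    obtain ⟨p', hp', hbp'⟩ := mem_foldr_union.mp hb
    exact hp p' hp' a ha b hbp'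

/-- every repair of `db` satisfies a minimal BCQ `q` iff, for each
connected component `qᵢ` of `q`, every repair of `db` satisfies `qᵢ`. -/
theorem statement_14 (pk : ℕ → Set ℕ) (q : Finset GAtom) (hmin : GMinimal q)
    (qs : List (Finset GAtom)) (hcomp : IsComponents q qs)
    (db : Set GFact) (hfin : db.Finite) :
    (∀ r, GIsRepair pk db r → GSat r q) ↔
      ∀ p ∈ qs, ∀ r, GIsRepair pk db r → GSat r p := by
  obtain ⟨hsub, hq, hdisj⟩ := hcomp
  refine ⟨fun h p hp r hr => (h r hr).mono (hsub p hp).2.2, fun h r hr => ?_⟩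
  rw [hq]
  exact GSat.foldr_union (hdisj.imp And.right) fun p hp => h p hp r hr

end CQAG
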